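/- For every integer t ≥ 1, the thickness of the complete graph K_{6t+1} equals t+1. -/

import Mathlib

open SimpleGraph

/-- A graph is planar if it has a drawing in the plane: vertices map injectively to points,
edges map to arcs between their endpoints, arc interiors avoid vertex images, and the
interiors of arcs of distinct edges are disjoint. -/
def SimpleGraph.IsPlanar {V : Type*} (G : SimpleGraph V) : Prop :=
  ∃ f : V → ℝ × ℝ, Function.Injective f ∧
    ∃ γ : ∀ ⦃u v : V⦄, G.Adj u v → _root_.Path (f u) (f v),
      (∀ ⦃u v : V⦄ (h : G.Adj u v), Function.Injective (γ h)) ∧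
      (∀ ⦃u v : V⦄ (h : G.Adj u v) (t : unitInterval), t ≠ 0 → t ≠ 1 → ∀ w, γ h t ≠ f w) ∧
      (∀ ⦃u v u' v' : V⦄ (h : G.Adj u v) (h' : G.Adj u' v'), s(u, v) ≠ s(u', v') →
        ∀ s t : unitInterval, s ≠ 0 → s ≠ 1 → γ h s ≠ γ h' t)

/-- The cone over `G`: a new vertex `none` joined to every vertex of `G`. -/
def SimpleGraph.cone {V : Type*} (G : SimpleGraph V) : SimpleGraph (Option V) :=
  SimpleGraph.fromRel
    (fun x y => (∃ u v, x = some u ∧ y = some v ∧ G.Adj u v) ∨ x = none)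

/-- A graph is outerplanar iff the cone over it is planar. -/
def SimpleGraph.IsOuterplanar {V : Type*} (G : SimpleGraph V) : Prop :=
  G.cone.IsPlanar

/-- A complete `k`-coloring: surjective, and every pair of distinct colors appears on an edge. -/
def SimpleGraph.IsCompleteColoring {V : Type*} {k : ℕ} (G : SimpleGraph V)
    (c : V → Fin k) : Prop :=
  Function.Surjective c ∧
    ∀ i j : Fin k, i ≠ j → ∃ u v, G.Adj u v ∧ c u = i ∧ c v = j

/-- A proper coloring: adjacent vertices receive distinct colors. -/
def SimpleGraph.IsProperColoring {V : Type*} {k : ℕ} (G : SimpleGraph V)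
    (c : V → Fin k) : Prop :=
  ∀ ⦃u v : V⦄, G.Adj u v → c u ≠ c v

/-- The pseudoachromatic number: the largest `k` admitting a complete `k`-coloring. -/
noncomputable def SimpleGraph.pseudoachromatic {V : Type*} (G : SimpleGraph V) : ℕ :=
  sSup {k | ∃ c : V → Fin k, G.IsCompleteColoring c}

/-- The achromatic number: the largest `k` admitting a proper complete `k`-coloring. -/
noncomputable def SimpleGraph.achromatic {V : Type*} (G : SimpleGraph V) : ℕ :=
  sSup {k | ∃ c : V → Fin k, G.IsProperColoring c ∧ G.IsCompleteColoring c}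

/-- The chromatic number: the least `k` admitting a proper `k`-coloring. -/
noncomputable def SimpleGraph.chromNum {V : Type*} (G : SimpleGraph V) : ℕ :=
  sInf {k | ∃ c : V → Fin k, G.IsProperColoring c}

/-- The thickness: the least number of planar subgraphs whose union is `G`. -/
noncomputable def SimpleGraph.thickness {V : Type*} (G : SimpleGraph V) : ℕ :=
  sInf {k | ∃ f : Fin k → SimpleGraph V, (∀ i, (f i).IsPlanar) ∧ (⨆ i, f i) = G}

/-- The outerthickness: the least number of outerplanar subgraphs whose union is `G`. -/
noncomputable def SimpleGraph.outerthickness {V : Type*} (G : SimpleGraph V) : ℕ :=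
  sInf {k | ∃ f : Fin k → SimpleGraph V, (∀ i, (f i).IsOuterplanar) ∧ (⨆ i, f i) = G}

/-- The 4-girth-thickness: the least number of planar subgraphs of girth at least 4
whose union is `G`. -/
noncomputable def SimpleGraph.girth4Thickness {V : Type*} (G : SimpleGraph V) : ℕ :=
  sInf {k | ∃ f : Fin k → SimpleGraph V,
    (∀ i, (f i).IsPlanar ∧ 4 ≤ (f i).egirth) ∧ (⨆ i, f i) = G}

theorem exists_continuous_exp_eq {g : unitInterval × unitInterval → ℂ} (hg : Continuous g)
    (h0 : ∀ x, g x ≠ 0) :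
    ∃ L : unitInterval × unitInterval → ℂ, Continuous L ∧ ∀ x, Complex.exp (L x) = g x := by
  let proj : ℝ × ℝ → unitInterval × unitInterval :=
    fun x ↦ (Set.projIcc 0 1 zero_le_one x.1, Set.projIcc 0 1 zero_le_one x.2)
  have hproj : Continuous proj := by
    have := continuous_projIcc (h := zero_le_one' ℝ)
    fun_prop
  have : ContractibleSpace (ℝ × ℝ) := RealTopologicalVectorSpace.contractibleSpace
  obtain ⟨F, ⟨-, hF⟩, -⟩ := Complex.isCoveringMapOn_exp.existsUnique_continuousMap_lifts
    ⟨g ∘ proj, hg.comp hproj⟩ (a₀ := 0) (Complex.exp_log (h0 (proj 0))) (fun x ↦ h0 (proj x))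
  refine ⟨fun x ↦ F (x.1, x.2), by fun_prop, fun x ↦ ?_⟩
  simpa [proj] using congrFun hF ((x.1 : ℝ), (x.2 : ℝ))

open Complex in
theorem sub_eq_sub_of_exp_eq {X : Type*} [TopologicalSpace X] [PreconnectedSpace X]
    {L M : X → ℂ} (hL : Continuous L) (hM : Continuous M) (h : ∀ x, exp (L x) = exp (M x))
    (x y : X) : L y - L x = M y - M x := by
  let N : X → ℂ := fun z ↦ M z + (L x - M x)
  have hN : L = N := by
    have key : ∀ z, exp (N z) = exp (L z) := fun z ↦ by
      simp only [N, Complex.exp_add, Complex.exp_sub, h]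
      rw [div_self (exp_ne_zero _), mul_one]
    refine isCoveringMap_exp.eq_of_comp_eq hL (by fun_prop) ?_ x (by simp [N])
    funext z
    exact Subtype.ext (key z).symm
  have := congrFun hN y
  simp only [N] at this
  rw [this]; ring

/-- The increment of a continuous logarithm of `γ - z` along the path `γ`. -/
noncomputable def Path.logIncrement {p q : ℂ} (γ : _root_.Path p q) (z : ℂ) : ℂ :=
  open Classical in
  if h : ∃ L : unitInterval → ℂ, Continuous L ∧ ∀ t, Complex.exp (L t) = γ t - z then
    h.choose 1 - h.choose 0
  else 0

theorem Path.logIncrement_eq {p q : ℂ} (γ : _root_.Path p q) {z : ℂ} {L : unitInterval → ℂ}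
    (hL : Continuous L) (h : ∀ t, Complex.exp (L t) = γ t - z) :
    γ.logIncrement z = L 1 - L 0 := by
  have hex : ∃ L : unitInterval → ℂ, Continuous L ∧ ∀ t, Complex.exp (L t) = γ t - z := ⟨L, hL, h⟩
  rw [Path.logIncrement, dif_pos hex]
  exact sub_eq_sub_of_exp_eq hex.choose_spec.1 hL
    (fun t ↦ (hex.choose_spec.2 t).trans (h t).symm) 0 1

theorem Path.exists_logIncrement_eq {p q : ℂ} (γ : _root_.Path p q) {z a b : ℂ}
    (hz : ∀ t, γ t ≠ z) (ha : Complex.exp a = p - z) (hb : Complex.exp b = q - z) :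
    ∃ n : ℤ, γ.logIncrement z = b - a + n * (2 * Real.pi * Complex.I) := by
  obtain ⟨M, hM, hexp⟩ := exists_continuous_exp_eq (g := fun x ↦ γ x.1 - z) (by fun_prop)
    (fun x ↦ sub_ne_zero.2 (hz x.1))
  obtain ⟨L, hL, h⟩ : ∃ L : unitInterval → ℂ, Continuous L ∧ ∀ t, Complex.exp (L t) = γ t - z :=
    ⟨fun t ↦ M (t, 0), by fun_prop, fun t ↦ hexp (t, 0)⟩
  rw [γ.logIncrement_eq hL h]
  obtain ⟨m, hm⟩ := Complex.exp_eq_exp_iff_exists_int.1 ((h 0).trans (by simpa using ha.symm))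
  obtain ⟨n, hn⟩ := Complex.exp_eq_exp_iff_exists_int.1 ((h 1).trans (by simpa using hb.symm))
  refine ⟨n - m, ?_⟩
  rw [hm, hn]; push_cast; ring

theorem Path.logIncrement_sub_logIncrement {p q r s : ℂ} (γ : _root_.Path p q) (δ : _root_.Path r s)
    (h : ∀ t u, γ t ≠ δ u) :
    γ.logIncrement r - γ.logIncrement s = δ.logIncrement p - δ.logIncrement q := by
  obtain ⟨L, hL, hexp⟩ := exists_continuous_exp_eq
    (g := fun x : unitInterval × unitInterval ↦ γ x.1 - δ x.2) (by fun_prop)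
    (fun x ↦ sub_ne_zero.2 (h _ _))
  have hneg (x) : Complex.exp (L x + Real.pi * Complex.I) = δ x.2 - γ x.1 := by
    rw [Complex.exp_add, Complex.exp_pi_mul_I, hexp]; ring
  rw [γ.logIncrement_eq (L := fun t ↦ L (t, 0)) (by fun_prop) (by simp [hexp]),
    γ.logIncrement_eq (L := fun t ↦ L (t, 1)) (by fun_prop) (by simp [hexp]),
    δ.logIncrement_eq (L := fun t ↦ L (0, t) + Real.pi * Complex.I) (by fun_prop) (by simp [hneg]),
    δ.logIncrement_eq (L := fun t ↦ L (1, t) + Real.pi * Complex.I) (by fun_prop) (by simp [hneg])]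
  ring

/-- `K₅` is not planar, in the strong form due to van Kampen and Flores: if five points of the plane
are joined pairwise by paths, then two paths without a common endpoint meet. -/
theorem exists_path_eq_path_of_five_points (p : Fin 5 → ℂ)
    (γ : ∀ i j, i < j → _root_.Path (p i) (p j)) :
    ∃ i j k l, ∃ (hij : i < j) (hkl : k < l), i ≠ k ∧ i ≠ l ∧ j ≠ k ∧ j ≠ l ∧
      ∃ t u, γ i j hij t = γ k l hkl u := by
  by_contra! hγ
  have havoid : ∀ i j k (hij : i < j), i ≠ k → j ≠ k → ∀ t, γ i j hij t ≠ p k := by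
    intro i j k hij hik hjk t
    obtain ⟨l, hli, hlj, hlk⟩ : ∃ l, l ≠ i ∧ l ≠ j ∧ l ≠ k := by
      clear hγ; revert i j k; decide
    rcases lt_or_gt_of_ne hlk with hl | hl
    · simpa using hγ i j l k hij hl hli.symm hik hlj.symm hjk t 1
    · simpa using hγ i j k l hij hl hik hli.symm hjk hlj.symm t 0
  have hne : ∀ i k, i ≠ k → p i - p k ≠ 0 := by
    intro i k hik
    obtain ⟨l, hli, hlk⟩ : ∃ l, l ≠ i ∧ l ≠ k := by
      clear hγ havoid; revert i k; decide
    rcases lt_or_gt_of_ne hli with hl | hl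
    · simpa [sub_eq_zero] using havoid l i k hl hlk hik 1
    · simpa [sub_eq_zero] using havoid i l k hl hik hlk 0
  let θ : Fin 5 → Fin 5 → ℂ := fun i k ↦
    if i < k then Complex.log (p i - p k) else Complex.log (p k - p i) + Real.pi * Complex.I
  have hθ : ∀ i k, i ≠ k → Complex.exp (θ i k) = p i - p k := by
    intro i k hik
    simp only [θ]
    split_ifs
    · exact Complex.exp_log (hne i k hik)
    · rw [Complex.exp_add, Complex.exp_pi_mul_I, Complex.exp_log (hne k i hik.symm)]; ring
  let ε : Fin 5 → Fin 5 → ℤ := fun i k ↦ if i < k then -1 else 1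
  have hθε : ∀ i k, i ≠ k → θ i k = θ k i + ε i k * (Real.pi * Complex.I) := by
    intro i k hik
    rcases lt_or_gt_of_ne hik with h | h
    · simp [θ, ε, h, h.not_gt]
    · simp [θ, ε, h, h.not_gt]
  have hn : ∀ i j k, ∃ n : ℤ, ∀ hij : i < j, i ≠ k → j ≠ k → (γ i j hij).logIncrement (p k) =
      θ j k - θ i k + n * (2 * Real.pi * Complex.I) := by
    intro i j k
    by_cases hij : i < j ∧ i ≠ k ∧ j ≠ k
    · obtain ⟨n, hn⟩ := (γ i j hij.1).exists_logIncrement_eq (havoid i j k hij.1 hij.2.1 hij.2.2)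
        (hθ i k hij.2.1) (hθ j k hij.2.2)
      exact ⟨n, fun _ _ _ ↦ hn⟩
    · exact ⟨0, fun h₁ h₂ h₃ ↦ absurd ⟨h₁, h₂, h₃⟩ hij⟩
  choose n hn using hn
  have key : ∀ i j k l, i < j → k < l → i ≠ k → i ≠ l → j ≠ k → j ≠ l →
      ε j k - ε i k - ε j l + ε i l + 2 * (n i j k - n i j l - n k l i + n k l j) = 0 := by
    intro i j k l hij hkl hik hil hjk hjl
    have := (γ i j hij).logIncrement_sub_logIncrement (γ k l hkl)
      (hγ i j k l hij hkl hik hil hjk hjl)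
    rw [hn i j k hij hik hjk, hn i j l hij hil hjl, hn k l i hkl hik.symm hil.symm,
      hn k l j hkl hjk.symm hjl.symm, hθε j k hjk, hθε i k hik, hθε j l hjl, hθε i l hil] at this
    have hpi : (Real.pi * Complex.I : ℂ) ≠ 0 := by simp [Real.pi_ne_zero]
    have h' : (Real.pi * Complex.I : ℂ) * ((ε j k - ε i k - ε j l + ε i l +
        2 * (n i j k - n i j l - n k l i + n k l j) : ℤ) : ℂ) = 0 := by
      push_cast
      linear_combination this
    exact_mod_cast (mul_eq_zero.1 h').resolve_left hpi
  have k1 := key 0 1 2 3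
  have k2 := key 0 1 2 4
  have k3 := key 0 1 3 4
  have k4 := key 0 2 1 3
  have k5 := key 0 2 1 4
  have k6 := key 0 2 3 4
  have k7 := key 0 3 1 2
  have k8 := key 0 3 1 4
  have k9 := key 0 3 2 4
  have k10 := key 0 4 1 2
  have k11 := key 0 4 1 3
  have k12 := key 0 4 2 3
  have k13 := key 1 2 3 4
  have k14 := key 1 3 2 4
  have k15 := key 1 4 2 3
  simp [ε] at k1 k2 k3 k4 k5 k6 k7 k8 k9 k10 k11 k12 k13 k14 k15
  omega

namespace SimpleGraph

variable {V : Type*}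

/-- A graph is weakly planar if it can be drawn in the plane so that edges without a common
endpoint are drawn disjointly. -/
def IsWeaklyPlanar (G : SimpleGraph V) : Prop :=
  ∃ (f : V → ℂ) (S : V → V → Set ℂ), (∀ u v, G.Adj u v → JoinedIn (S u v) (f u) (f v)) ∧
    ∀ u v u' v', G.Adj u v → G.Adj u' v' → u ≠ u' → u ≠ v' → v ≠ u' → v ≠ v' →
      Disjoint (S u v) (S u' v')

theorem IsPlanar.isWeaklyPlanar {G : SimpleGraph V} (h : G.IsPlanar) : G.IsWeaklyPlanar := by
  obtain ⟨f, hf, γ, -, hint, hdisj⟩ := h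
  let e : ℝ × ℝ → ℂ := Complex.equivRealProdCLM.symm
  have he : Continuous e := Complex.equivRealProdCLM.symm.continuous
  have hinj : Function.Injective e := Complex.equivRealProdCLM.symm.injective
  refine ⟨fun v ↦ e (f v), fun u v ↦ {z | ∃ (h : G.Adj u v) (t : unitInterval), e (γ h t) = z},
    fun u v h ↦ ⟨(γ h).map he, fun t ↦ ⟨h, t, rfl⟩⟩, ?_⟩
  intro u v u' v' _ _ huu huv hvu hvv
  rw [Set.disjoint_left]
  rintro _ ⟨h, s, rfl⟩ ⟨h', t, hst⟩
  replace hst := hinj hst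
  by_cases hs : s ≠ 0 ∧ s ≠ 1
  · exact hdisj h h' (by simp [huu, huv]) s t hs.1 hs.2 hst.symm
  have hs' : γ h s = f u ∨ γ h s = f v := by
    rcases not_and_or.1 hs with h | h <;> rw [not_not.1 h] <;> simp
  by_cases ht : t ≠ 0 ∧ t ≠ 1
  · rcases hs' with hs' | hs' <;> exact hint h' t ht.1 ht.2 _ (hst.trans hs')
  have ht' : γ h' t = f u' ∨ γ h' t = f v' := by
    rcases not_and_or.1 ht with h | h <;> rw [not_not.1 h] <;> simp
  rcases hs' with hs' | hs' <;> rcases ht' with ht' | ht' <;> rw [hs', ht'] at hst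
  exacts [huu (hf hst).symm, huv (hf hst).symm, hvu (hf hst).symm, hvv (hf hst).symm]

theorem IsWeaklyPlanar.mono {G H : SimpleGraph V} (h : H.IsWeaklyPlanar) (hle : G ≤ H) :
    G.IsWeaklyPlanar := by
  obtain ⟨f, S, hS, hd⟩ := h
  exact ⟨f, S, fun u v h ↦ hS u v (hle h), fun u v u' v' h h' ↦ hd u v u' v' (hle h) (hle h')⟩

theorem IsWeaklyPlanar.cliqueFree_five {G : SimpleGraph V} (h : G.IsWeaklyPlanar) :
    G.CliqueFree 5 := by
  by_contra hG
  let φ := topEmbeddingOfNotCliqueFree hG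
  obtain ⟨f, S, hS, hd⟩ := h
  have hadj : ∀ i j, i < j → G.Adj (φ i) (φ j) := fun i j hij ↦
    φ.map_adj_iff.2 ((top_adj _ _).2 hij.ne)
  obtain ⟨i, j, k, l, hij, hkl, hik, hil, hjk, hjl, t, u, htu⟩ :=
    exists_path_eq_path_of_five_points (fun i ↦ f (φ i))
      (fun i j hij ↦ (hS _ _ (hadj i j hij)).somePath)
  have hφ : ∀ {a b}, a ≠ b → φ a ≠ φ b := fun h ↦ φ.injective.ne h
  exact Set.disjoint_left.1 (hd _ _ _ _ (hadj i j hij) (hadj k l hkl) (hφ hik) (hφ hil) (hφ hjk)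
    (hφ hjl)) (JoinedIn.somePath_mem _ t) (htu ▸ JoinedIn.somePath_mem _ u)

/-- The graph in which all edges at `v` are moved to `x`, and `v` becomes isolated. If `v` and `x`
are adjacent, this is the contraction of the edge `vx` into `x`. -/
def contractInto (G : SimpleGraph V) (v x : V) : SimpleGraph V where
  Adj a b := a ≠ b ∧ a ≠ v ∧ b ≠ v ∧ (G.Adj a b ∨ (a = x ∧ G.Adj v b) ∨ (b = x ∧ G.Adj a v))
  symm := ⟨by
    rintro a b ⟨hab, ha, hb, h⟩
    exact ⟨hab.symm, hb, ha, h.imp Adj.symm fun h ↦ h.symm.imp (And.imp_right Adj.symm)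
      (And.imp_right Adj.symm)⟩⟩
  loopless := ⟨fun a h ↦ h.1 rfl⟩

theorem IsWeaklyPlanar.contractInto {G : SimpleGraph V} (h : G.IsWeaklyPlanar) {v x : V}
    (hvx : G.Adj v x) : (G.contractInto v x).IsWeaklyPlanar := by
  obtain ⟨f, S, hS, hd⟩ := h
  have hjoin : ∀ a b, ∃ T : Set ℂ, (G.contractInto v x).Adj a b →
      JoinedIn T (f a) (f b) ∧ ∀ z ∈ T, ∃ c d, G.Adj c d ∧ z ∈ S c d ∧
        (c = a ∨ c = b ∨ (c = v ∧ (a = x ∨ b = x))) ∧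
        (d = a ∨ d = b ∨ (d = v ∧ (a = x ∨ b = x))) := by
    intro a b
    by_cases hab : (G.contractInto v x).Adj a b
    · obtain ⟨-, -, -, hab | ⟨rfl, hab⟩ | ⟨rfl, hab⟩⟩ := hab
      · exact ⟨S a b, fun _ ↦ ⟨hS _ _ hab, fun z hz ↦ ⟨a, b, hab, hz, by simp, by simp⟩⟩⟩
      · refine ⟨S a v ∪ S v b, fun _ ↦ ⟨((hS _ _ hvx.symm).mono Set.subset_union_left).trans
          ((hS _ _ hab).mono Set.subset_union_right), ?_⟩⟩
        rintro z (hz | hz)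
        · exact ⟨a, v, hvx.symm, hz, by simp, by simp⟩
        · exact ⟨v, b, hab, hz, by simp, by simp⟩
      · refine ⟨S a v ∪ S v b, fun _ ↦ ⟨((hS _ _ hab).mono Set.subset_union_left).trans
          ((hS _ _ hvx).mono Set.subset_union_right), ?_⟩⟩
        rintro z (hz | hz)
        · exact ⟨a, v, hab, hz, by simp, by simp⟩
        · exact ⟨v, b, hvx, hz, by simp, by simp⟩
    · exact ⟨∅, fun h ↦ absurd h hab⟩
  choose T hT using hjoin
  refine ⟨f, T, fun a b hab ↦ (hT a b hab).1, fun a b a' b' hab hab' h₁ h₂ h₃ h₄ ↦ ?_⟩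
  rw [Set.disjoint_left]
  intro z hz hz'
  obtain ⟨c, d, hcd, hzcd, hc, hd₁⟩ := (hT a b hab).2 z hz
  obtain ⟨c', d', hcd', hzcd', hc', hd'⟩ := (hT a' b' hab').2 z hz'
  have hav := hab.2.1
  have hbv := hab.2.2.1
  have hav' := hab'.2.1
  have hbv' := hab'.2.2.1
  refine Set.disjoint_left.1 (hd c d c' d' hcd hcd' ?_ ?_ ?_ ?_) hzcd hzcd' <;> grind

open Finset Classical in
theorem card_edgeFinset_add_card_le_contractInto [Fintype V] {G : SimpleGraph V} {v x : V}
    (hvx : G.Adj v x) {Y : Finset V} (hY : ∀ y ∈ Y, G.Adj v y ∧ y ≠ x ∧ ¬ G.Adj x y) :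
    #G.edgeFinset + #Y ≤ #(G.contractInto v x).edgeFinset + G.degree v := by
  have hdisj : Disjoint (G.edgeFinset \ G.incidenceFinset v) (Y.image fun y ↦ s(x, y)) := by
    rw [Finset.disjoint_right]
    intro e he
    obtain ⟨y, hy, rfl⟩ := Finset.mem_image.1 he
    simp [(hY y hy).2.2]
  have hsub : (G.edgeFinset \ G.incidenceFinset v) ∪ (Y.image fun y ↦ s(x, y)) ⊆
      (G.contractInto v x).edgeFinset := by
    refine Finset.union_subset ?_ ?_
    · intro e
      induction e with | _ a b
      simp only [mem_sdiff, mem_edgeFinset, mem_incidenceFinset, mem_edgeSet, incidenceSet]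
      rintro ⟨hab, h⟩
      refine ⟨hab.ne, ?_, ?_, Or.inl hab⟩ <;> rintro rfl <;> exact h ⟨hab, by simp⟩
    · intro e he
      obtain ⟨y, hy, rfl⟩ := Finset.mem_image.1 he
      obtain ⟨h₁, h₂, -⟩ := hY y hy
      rw [mem_edgeFinset, mem_edgeSet]
      exact ⟨h₂.symm, hvx.ne', h₁.ne', Or.inr (Or.inl ⟨rfl, h₁⟩)⟩
  have hcard := Finset.card_le_card hsub
  rw [Finset.card_union_of_disjoint hdisj, Finset.card_image_of_injective _
    (fun a b h ↦ Sym2.congr_right.1 h)] at hcard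
  have := Finset.le_card_sdiff (G.incidenceFinset v) G.edgeFinset
  rw [card_incidenceFinset_eq_degree] at this
  omega

/-- If the neighbourhood of `v` has five vertices and its complement is a matching, then `G` has
a `K₅` minor. -/
theorem not_isWeaklyPlanar_of_neighborhood {G : SimpleGraph V} {v : V} {N : Finset V}
    (hN : N.card = 5) (hv : ∀ x ∈ N, G.Adj v x)
    (hmatch : ∀ x ∈ N, ∀ y ∈ N, ∀ z ∈ N, y ≠ x → z ≠ x → ¬ G.Adj x y → ¬ G.Adj x z → y = z) :
    ¬ G.IsWeaklyPlanar := by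
  classical
  intro hG
  have hvN : v ∉ N := fun h ↦ (hv v h).ne rfl
  have hcliq : ∀ c ∈ N, ∀ H : SimpleGraph V, H.IsWeaklyPlanar → (∀ x ∈ N.erase c, H.Adj v x) →
      ¬ ∀ x ∈ N.erase c, ∀ y ∈ N.erase c, x ≠ y → H.Adj x y := by
    intro c hc H hH hHv hadj
    refine hH.cliqueFree_five (insert v (N.erase c)) ⟨?_, ?_⟩
    · rw [Finset.coe_insert]
      exact (show H.IsClique (N.erase c : Finset V) from
        fun x hx y hy hxy ↦ hadj x hx y hy hxy).insert fun b hb _ ↦ hHv b hb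
    · rw [Finset.card_insert_of_notMem (fun h ↦ hvN (Finset.mem_of_mem_erase h)),
        Finset.card_erase_of_mem hc, hN]
  have hsym : ∀ {a b}, ¬ G.Adj a b → ¬ G.Adj b a := fun h h' ↦ h h'.symm
  by_cases h₁ : ∃ c ∈ N, ∃ d ∈ N, c ≠ d ∧ ¬ G.Adj c d
  · obtain ⟨c, hc, d, hd, hcd, hcd'⟩ := h₁
    by_cases h₂ : ∃ a ∈ N, ∃ b ∈ N, a ≠ b ∧ ¬ G.Adj a b ∧ a ≠ c ∧ a ≠ d ∧ b ≠ c ∧ b ≠ d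
    · obtain ⟨a, ha, b, hb, hab, hab', hac, had, hbc, hbd⟩ := h₂
      have hac' : G.Adj a c := by
        by_contra h
        exact hbc (hmatch a ha b hb c hc hab.symm hac.symm hab' h)
      have had' : G.Adj a d := by
        by_contra h
        exact hbd (hmatch a ha b hb d hd hab.symm had.symm hab' h)
      have hrest : ((((N.erase a).erase b).erase c).erase d).card = 1 := by
        rw [Finset.card_erase_of_mem, Finset.card_erase_of_mem, Finset.card_erase_of_mem,
          Finset.card_erase_of_mem, hN] <;> grind
      refine hcliq a ha _ (hG.contractInto hac') (fun x hx ↦ ?_) (fun x hx y hy hxy ↦ ?_)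
      · have := hv x (Finset.mem_of_mem_erase hx)
        exact ⟨this.ne, (hv a ha).ne, Finset.ne_of_mem_erase hx, Or.inl this⟩
      · have hxN := Finset.mem_of_mem_erase hx
        have hyN := Finset.mem_of_mem_erase hy
        refine ⟨hxy, Finset.ne_of_mem_erase hx, Finset.ne_of_mem_erase hy, ?_⟩
        by_contra! h
        obtain ⟨h, hx', hy'⟩ := h
        by_cases hxc : x = c
        · subst hxc
          rw [hmatch x hxN y hyN d hd hxy.symm hcd.symm h hcd'] at hx'
          exact hx' rfl had'
        by_cases hyc : y = c
        · subst hyc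
          rw [hmatch y hyN x hxN d hd hxy hcd.symm (hsym h) hcd'] at hy'
          exact hy' rfl had'.symm
        have hxd : x ≠ d := by
          rintro rfl
          exact hyc (hmatch x hxN y hyN c hc hxy.symm hcd h (hsym hcd'))
        have hyd : y ≠ d := by
          rintro rfl
          exact hxc (hmatch y hyN x hxN c hc hxy hcd (hsym h) (hsym hcd'))
        have hxb : x ≠ b := by
          rintro rfl
          exact Finset.ne_of_mem_erase hy (hmatch x hxN y hyN a ha hxy.symm hab h (hsym hab'))
        have hyb : y ≠ b := by
          rintro rfl
          exact Finset.ne_of_mem_erase hx (hmatch y hyN x hxN a ha hxy hab (hsym h) (hsym hab'))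
        exact hxy (Finset.card_le_one.1 hrest.le x (by simp_all) y (by simp_all))
    · refine hcliq c hc G hG (fun x hx ↦ hv x (Finset.mem_of_mem_erase hx)) fun x hx y hy hxy ↦ ?_
      obtain ⟨hxc, hxN⟩ := Finset.mem_erase.1 hx
      obtain ⟨hyc, hyN⟩ := Finset.mem_erase.1 hy
      by_contra h
      refine h₂ ⟨x, hxN, y, hyN, hxy, h, hxc, ?_, hyc, ?_⟩
      · rintro rfl
        exact hyc (hmatch x hxN y hyN c hc hxy.symm hcd h (hsym hcd'))
      · rintro rfl
        exact hxc (hmatch y hyN x hxN c hc hxy hcd (hsym h) (hsym hcd'))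
  · push Not at h₁
    exact hG.cliqueFree_five N ⟨fun x hx y hy hxy ↦ h₁ x hx y hy hxy, hN⟩

open Finset Classical in
theorem exists_le_card_edgeFinset_eq [Fintype V] {G : SimpleGraph V} {m : ℕ}
    (hm : m ≤ #G.edgeFinset) : ∃ H ≤ G, #H.edgeFinset = m := by
  obtain ⟨T, hT, hTcard⟩ := Finset.exists_subset_card_eq hm
  refine ⟨fromEdgeSet (T : Set (Sym2 V)), fun a b h ↦ ?_, ?_⟩
  · simpa using hT (Finset.mem_coe.1 ((fromEdgeSet_adj _).1 h).1)
  · rw [← hTcard]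
    congr 1
    ext e
    simp only [mem_edgeFinset, edgeSet_fromEdgeSet, Set.mem_sdiff, Finset.mem_coe]
    exact ⟨And.left, fun h ↦ ⟨h, not_isDiag_of_mem_edgeFinset (hT h)⟩⟩

open Finset Classical in
theorem IsWeaklyPlanar.card_edgeFinset_add_three_le_of_subset [Fintype V] (s : Finset V)
    (hs : s.Nonempty) (G : SimpleGraph V) (hG : G.IsWeaklyPlanar)
    (hsub : ∀ a b, G.Adj a b → a ∈ s) : #G.edgeFinset + 3 ≤ 3 * #s := by
  induction hn : #s generalizing s G with
  | zero => simp_all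
  | succ n ih =>
    by_contra! hlt
    wlog hcard : #G.edgeFinset = 3 * n + 1 generalizing G
    · obtain ⟨H, hle, hH⟩ := exists_le_card_edgeFinset_eq (G := G) (m := 3 * n + 1) (by omega)
      exact this H (hG.mono hle) (fun a b h ↦ hsub a b (hle h)) (by omega) hH
    have hn0 : n ≠ 0 := by
      rintro rfl
      obtain ⟨e, he⟩ := Finset.card_pos.1 (show 0 < #G.edgeFinset by omega)
      induction e with | _ a b
      have hab : G.Adj a b := by simpa using he
      exact hab.ne (Finset.card_le_one.1 (by omega) a (hsub a b hab) b (hsub b a hab.symm))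
    obtain ⟨v, hv, hdeg⟩ : ∃ v ∈ s, G.degree v ≤ 5 := by
      by_contra! h
      have h₁ : ∑ v ∈ s, 6 ≤ ∑ v ∈ s, G.degree v := Finset.sum_le_sum fun v hv ↦ h v hv
      have h₂ : ∑ v ∈ s, G.degree v ≤ ∑ v, G.degree v :=
        Finset.sum_le_sum_of_subset (Finset.subset_univ s)
      rw [sum_degrees_eq_twice_card_edges] at h₂
      simp only [sum_const, smul_eq_mul] at h₁
      omega
    have hcs : #(s.erase v) = n := by rw [Finset.card_erase_of_mem hv]; omega
    have hne : (s.erase v).Nonempty := Finset.card_pos.1 (by omega)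
    have hcontract : ∀ x, G.Adj v x → ∀ Y : Finset V,
        (∀ y ∈ Y, G.Adj v y ∧ y ≠ x ∧ ¬ G.Adj x y) → #Y + 4 ≤ G.degree v := by
      intro x hvx Y hY
      have h₁ := card_edgeFinset_add_card_le_contractInto hvx hY
      have h₂ := ih (s.erase v) hne _ (hG.contractInto hvx) (fun a b hab ↦ ?_) hcs
      · omega
      · refine Finset.mem_erase.2 ⟨hab.2.1, ?_⟩
        rcases hab.2.2.2 with h | ⟨rfl, -⟩ | ⟨-, h⟩
        exacts [hsub a b h, hsub a v hvx.symm, hsub a v h]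
    have hdeg0 : G.degree v ≠ 0 := by
      intro h0
      have := ih (s.erase v) hne G hG (fun a b hab ↦ Finset.mem_erase.2 ⟨?_, hsub a b hab⟩) hcs
      · omega
      · rintro rfl
        rw [degree_eq_zero_iff_notMem_support] at h0
        exact h0 ⟨b, hab⟩
    obtain ⟨x, hx⟩ := (G.degree_pos_iff_exists_adj v).1 (Nat.pos_of_ne_zero hdeg0)
    have hdeg4 := hcontract x hx ∅ (by simp)
    have hN : #(G.neighborFinset v) = G.degree v := G.card_neighborFinset_eq_degree v
    rcases (show G.degree v = 4 ∨ G.degree v = 5 by simp at hdeg4; omega) with hd | hd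
    · refine hG.cliqueFree_five (insert v (G.neighborFinset v)) ⟨?_, ?_⟩
      · rw [Finset.coe_insert]
        refine IsClique.insert (fun a ha b hb hab ↦ ?_) (fun b hb _ ↦ by simpa using hb)
        by_contra h
        have := hcontract a (by simpa using ha) {b} (by simp_all [hab.symm])
        simp at this
        omega
      · rw [Finset.card_insert_of_notMem (by simp), hN, hd]
    · refine not_isWeaklyPlanar_of_neighborhood (hN.trans hd) (fun x hx ↦ by simpa using hx) ?_ hG
      intro x hx y hy z hz hyx hzx hxy hxz
      by_contra hyz
      have := hcontract x (by simpa using hx) {y, z} (by simp_all)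
      rw [Finset.card_pair hyz] at this
      omega

open Finset in
theorem IsPlanar.card_edgeFinset_add_three_le [Fintype V] [Nonempty V] {G : SimpleGraph V}
    [Fintype G.edgeSet] (hG : G.IsPlanar) : #G.edgeFinset + 3 ≤ 3 * Fintype.card V := by
  convert hG.isWeaklyPlanar.card_edgeFinset_add_three_le_of_subset Finset.univ
    Finset.univ_nonempty G (by simp)
  exact Finset.card_univ.symm

open Finset in
theorem card_edgeFinset_le_of_iSup_eq [Fintype V] [Nonempty V] {k : ℕ} {G : SimpleGraph V}
    [Fintype G.edgeSet] {f : Fin k → SimpleGraph V} (hf : ∀ i, (f i).IsPlanar)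
    (hG : ⨆ i, f i = G) : #G.edgeFinset ≤ k * (3 * Fintype.card V - 3) := by
  classical
  have hsub : G.edgeFinset ⊆ univ.biUnion fun i ↦ (f i).edgeFinset := by
    intro e
    induction e with | _ a b
    simp [← hG]
  calc #G.edgeFinset ≤ _ := Finset.card_le_card hsub
    _ ≤ ∑ i : Fin k, #(f i).edgeFinset := Finset.card_biUnion_le
    _ ≤ ∑ i : Fin k, (3 * Fintype.card V - 3) := Finset.sum_le_sum fun i _ ↦ by
        have := (hf i).card_edgeFinset_add_three_le; omega
    _ = k * (3 * Fintype.card V - 3) := by simp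

end SimpleGraph

/-- No two pairs of related numbers interleave: the pairs, drawn as arcs on one side of a line, do
not cross. -/
def IsNoncrossing (R : ℕ → ℕ → Prop) : Prop :=
  ∀ ⦃a b c d⦄, R a b → R c d → a < c → c < b → b < d → False

/-- The arc from `(a, 0)` to `(b, 0)` on the parabola with opening `σ`. -/
noncomputable def parabolicArc (σ a b : ℝ) : _root_.Path ((a, 0) : ℝ × ℝ) (b, 0) where
  toFun t := (a + t * (b - a), σ * (t * (1 - t) * (b - a) ^ 2))
  continuous_toFun := by fun_prop
  source' := by simp
  target' := by simp

theorem parabolicArc_snd (σ a b : ℝ) (t : unitInterval) :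
    (parabolicArc σ a b t).2 =
      σ * (((parabolicArc σ a b t).1 - a) * (b - (parabolicArc σ a b t).1)) := by
  change σ * (t * (1 - t) * (b - a) ^ 2) =
    σ * ((a + t * (b - a) - a) * (b - (a + t * (b - a))))
  ring

theorem sub_mul_sub_pos_of_parabolicArc (σ : ℝ) {a b : ℝ} (hab : a ≠ b) {t : unitInterval}
    (h0 : t ≠ 0) (h1 : t ≠ 1) :
    0 < ((parabolicArc σ a b t).1 - a) * (b - (parabolicArc σ a b t).1) := by
  change 0 < (a + t * (b - a) - a) * (b - (a + t * (b - a)))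
  have h₁ : (0 : ℝ) < t := unitInterval.pos_iff_ne_zero.2 h0
  have h₂ : (0 : ℝ) < 1 - t := sub_pos.2 (unitInterval.lt_one_iff_ne_one.2 h1)
  have h₃ : (0 : ℝ) < (b - a) ^ 2 := by
    have := sub_ne_zero.2 hab.symm
    positivity
  calc (0 : ℝ) < t * (1 - t) * (b - a) ^ 2 := by positivity
    _ = _ := by ring

theorem sub_mul_sub_nonneg_of_parabolicArc (σ a b : ℝ) (t : unitInterval) :
    0 ≤ ((parabolicArc σ a b t).1 - a) * (b - (parabolicArc σ a b t).1) := by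
  change 0 ≤ (a + t * (b - a) - a) * (b - (a + t * (b - a)))
  have h₁ : (0 : ℝ) ≤ t := t.2.1
  have h₂ : (0 : ℝ) ≤ 1 - t := sub_nonneg.2 t.2.2
  calc (0 : ℝ) ≤ t * (1 - t) * (b - a) ^ 2 := by positivity
    _ = _ := by ring

theorem IsNoncrossing.eq_of_sub_mul_sub_eq {R : ℕ → ℕ → Prop} (hR : IsNoncrossing R)
    {a b c d : ℕ} (hab : R a b) (hcd : R c d) (hlt : a < b) (hlt' : c < d) {x : ℝ}
    (hx : 0 < (x - a) * (b - x)) (h : (x - a) * (b - x) = (x - c) * (d - x)) :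
    a = c ∧ b = d := by
  have bounds : ∀ {m n : ℕ}, m < n → 0 < (x - m) * (n - x) → (m : ℝ) < x ∧ x < n := by
    intro m n hmn hpos
    have : (m : ℝ) < n := by exact_mod_cast hmn
    constructor <;> by_contra! hle <;> nlinarith
  obtain ⟨h₁, h₂⟩ := bounds hlt hx
  obtain ⟨h₃, h₄⟩ := bounds hlt' (h ▸ hx)
  have hcb : c < b := by exact_mod_cast h₃.trans h₂
  have had : a < d := by exact_mod_cast h₁.trans h₄
  have nested : ∀ {a b c d : ℕ}, (x - a) * (b - x) = (x - c) * (d - x) → (a : ℝ) < x → x < b →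
      (c : ℝ) < x → x < d → a ≤ c → d ≤ b → a = c ∧ b = d := by
    intro a b c d h h₁ h₂ h₃ h₄ hac hdb
    have hac' : (a : ℝ) ≤ c := by exact_mod_cast hac
    have hdb' : (d : ℝ) ≤ b := by exact_mod_cast hdb
    have e₁ : ((c : ℝ) - a) * (b - x) = 0 := by
      refine le_antisymm ?_ (mul_nonneg (by linarith) (by linarith))
      nlinarith [mul_nonneg (sub_nonneg.2 h₃.le) (sub_nonneg.2 hdb')]
    have hc : (c : ℝ) = a := by
      rcases mul_eq_zero.1 e₁ with h | h <;> linarith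
    have hd : (b : ℝ) = d := by
      rw [hc] at h
      have := mul_left_cancel₀ (sub_pos.2 h₁).ne' h
      linarith
    exact ⟨by exact_mod_cast hc.symm, by exact_mod_cast hd⟩
  rcases le_total a c with hac | hca <;> rcases le_total b d with hbd | hdb
  · rcases hac.eq_or_lt with rfl | hac'
    · obtain ⟨h₅, h₆⟩ := nested h.symm h₃ h₄ h₁ h₂ le_rfl hbd
      exact ⟨rfl, h₆.symm⟩
    · rcases hbd.eq_or_lt with rfl | hbd'
      · exact nested h h₁ h₂ h₃ h₄ hac le_rfl
      · exact (hR hab hcd hac' hcb hbd').elim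
  · exact nested h h₁ h₂ h₃ h₄ hac hdb
  · obtain ⟨h₅, h₆⟩ := nested h.symm h₃ h₄ h₁ h₂ hca hbd
    exact ⟨h₅.symm, h₆.symm⟩
  · rcases hca.eq_or_lt with rfl | hca'
    · exact nested h h₁ h₂ h₃ h₄ le_rfl hdb
    · rcases hdb.eq_or_lt with rfl | hdb'
      · obtain ⟨h₅, h₆⟩ := nested h.symm h₃ h₄ h₁ h₂ hca le_rfl
        exact ⟨h₅.symm, h₆.symm⟩
      · exact (hR hcd hab hca' had hdb').elim

namespace SimpleGraph

variable {V : Type*}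

/-- The graph whose vertices lie on a line at the positions `pos`, with edges given by a relation
on positions. -/
def ofPositions (pos : V → ℕ) (R : ℕ → ℕ → Prop) : SimpleGraph V where
  Adj u v := pos u < pos v ∧ R (pos u) (pos v) ∨ pos v < pos u ∧ R (pos v) (pos u)
  symm := ⟨fun _ _ h ↦ h.symm⟩
  loopless := ⟨fun _ h ↦ h.elim (fun h ↦ h.1.ne rfl) (fun h ↦ h.1.ne rfl)⟩

/-- A graph with a two-page book embedding is planar. -/
theorem isPlanar_ofPositions {pos : V → ℕ} (hpos : Function.Injective pos) {R S : ℕ → ℕ → Prop}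
    (hR : IsNoncrossing R) (hS : IsNoncrossing S) :
    (ofPositions pos fun a b ↦ R a b ∨ S a b).IsPlanar := by
  classical
  let page : ℕ → ℕ → ℝ := fun a b ↦ if R (min a b) (max a b) then 1 else -1
  have hpage : ∀ a b, page a b ≠ 0 := fun a b ↦ by simp only [page]; split_ifs <;> simp
  refine ⟨fun v ↦ (pos v, 0), fun u v h ↦ hpos (by simpa using h),
    fun u v _ ↦ parabolicArc (page (pos u) (pos v)) (pos u) (pos v), ?_, ?_, ?_⟩
  · intro u v h s t hst
    have hne : ((pos v : ℝ) - pos u) ≠ 0 :=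
      sub_ne_zero.2 (Nat.cast_injective.ne (hpos.ne h.ne'))
    have h₁ : (pos u : ℝ) + s * (pos v - pos u) = pos u + t * (pos v - pos u) :=
      congrArg Prod.fst hst
    exact Subtype.ext (mul_right_cancel₀ hne (add_left_cancel h₁))
  · intro u v h t h0 h1 w hw
    have hp := sub_mul_sub_pos_of_parabolicArc (page (pos u) (pos v))
      (Nat.cast_injective.ne (hpos.ne h.ne)) h0 h1
    have := parabolicArc_snd (page (pos u) (pos v)) (pos u) (pos v) t
    rw [hw] at this hp
    exact mul_ne_zero (hpage _ _) hp.ne' this.symm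
  · intro u v u' v' h h' hne s t h0 h1 hst
    apply hne
    have hp := sub_mul_sub_pos_of_parabolicArc (page (pos u) (pos v))
      (Nat.cast_injective.ne (hpos.ne h.ne)) h0 h1
    have e₁ := parabolicArc_snd (page (pos u) (pos v)) (pos u) (pos v) s
    have e₂ := parabolicArc_snd (page (pos u') (pos v')) (pos u') (pos v') t
    rw [← hst] at e₂
    set x := (parabolicArc (page (pos u) (pos v)) (pos u) (pos v) s).1
    have hp' : 0 ≤ (x - pos u') * (pos v' - x) := by
      have := sub_mul_sub_nonneg_of_parabolicArc (page (pos u') (pos v')) (pos u') (pos v') t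
      rwa [← hst] at this
    have hrel : ∀ {u v : V}, (ofPositions pos fun a b ↦ R a b ∨ S a b).Adj u v →
        min (pos u) (pos v) < max (pos u) (pos v) ∧
          (R (min (pos u) (pos v)) (max (pos u) (pos v)) ∨
            S (min (pos u) (pos v)) (max (pos u) (pos v))) := by
      rintro u v (⟨hlt, h⟩ | ⟨hlt, h⟩)
      · simpa [hlt.le, hlt] using h
      · simpa [hlt.le, hlt] using h
    have hminmax : ∀ a b : ℕ, (x - a) * (b - x) = (x - (min a b : ℕ)) * ((max a b : ℕ) - x) := by
      intro a b
      rcases le_total a b with h | h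
      · simp [h]
      · simp only [min_eq_right h, max_eq_left h]; ring
    obtain ⟨hlt, hRS⟩ := hrel h
    obtain ⟨hlt', hRS'⟩ := hrel h'
    rw [hminmax] at hp hp' e₁ e₂
    have key : min (pos u) (pos v) = min (pos u') (pos v') ∧
        max (pos u) (pos v) = max (pos u') (pos v') := by
      have e := e₁.symm.trans e₂
      simp only [page] at e
      split_ifs at e with h₁ h₂ h₂
      · exact hR.eq_of_sub_mul_sub_eq h₁ h₂ hlt hlt' hp (by linarith)
      · linarith
      · linarith
      · exact hS.eq_of_sub_mul_sub_eq (hRS.resolve_left h₁) (hRS'.resolve_left h₂) hlt hlt' hp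
          (by linarith)
    rw [Sym2.eq_iff, ← hpos.eq_iff, ← hpos.eq_iff, ← hpos.eq_iff, ← hpos.eq_iff]
    omega

end SimpleGraph

/-- The index of `d` in the sequence `0, 1, -1, 2, -2, …, p` of residues modulo `2 * p`. -/
def zigzagIndex (p d : ℕ) : ℕ :=
  if d = 0 then 0 else if d ≤ p then 2 * d - 1 else 4 * p - 2 * d

/-- The difference `a - b` modulo `m`, for `a, b < m`. -/
def modSub (m a b : ℕ) : ℕ := if b ≤ a then a - b else a + m - b

/-- The position of the `q`-th vertex of a path with `2 * p` vertices whose first half starts at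
position `a`, and whose second half starts, in reverse order, at position `b`. -/
def halvesPosition (p a b q : ℕ) : ℕ := if q < p then a + q else b + (2 * p - 1 - q)

theorem modSub_spec {m a b : ℕ} (hb : b ≤ m) :
    b ≤ a ∧ modSub m a b + b = a ∨ a < b ∧ modSub m a b + b = a + m := by
  unfold modSub
  split_ifs <;> omega

theorem zigzagIndex_spec (p d : ℕ) :
    d = 0 ∧ zigzagIndex p d = 0 ∨ 0 < d ∧ d ≤ p ∧ zigzagIndex p d + 1 = 2 * d ∨
      p < d ∧ zigzagIndex p d = 4 * p - 2 * d := by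
  unfold zigzagIndex
  split_ifs <;> omega

theorem halvesPosition_spec (p a b q : ℕ) :
    q < p ∧ halvesPosition p a b q = a + q ∨
      p ≤ q ∧ halvesPosition p a b q = b + (2 * p - 1 - q) := by
  unfold halvesPosition
  split_ifs <;> omega

theorem modSub_lt {m a b : ℕ} (ha : a < m) (hb : b ≤ m) : modSub m a b < m := by
  have := modSub_spec (a := a) hb
  omega

theorem zigzagIndex_lt {p d : ℕ} (hd : d < 2 * p) : zigzagIndex p d < 2 * p := by
  have := zigzagIndex_spec p d
  omega

theorem zigzagIndex_lt_iff {p d : ℕ} (hd : d < 2 * p) :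
    zigzagIndex p d < p ↔ 2 * d ≤ p ∨ 3 * p < 2 * d := by
  have := zigzagIndex_spec p d
  omega

theorem zigzagIndex_injective {p d e : ℕ} (hd : d < 2 * p) (he : e < 2 * p)
    (h : zigzagIndex p d = zigzagIndex p e) : d = e := by
  have := zigzagIndex_spec p d
  have := zigzagIndex_spec p e
  omega

theorem modSub_left_injective {m a b c : ℕ} (ha : a < m) (hb : b < m) (hc : c ≤ m)
    (h : modSub m a c = modSub m b c) : a = b := by
  have := modSub_spec (a := a) hc
  have := modSub_spec (a := b) hc
  omega

theorem modSub_right_injective {m a b c : ℕ} (hb : b < m) (hc : c < m)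
    (h : modSub m a b = modSub m a c) : b = c := by
  have := modSub_spec (a := a) hb.le
  have := modSub_spec (a := a) hc.le
  omega

theorem halvesPosition_injective {p a b q q' : ℕ} (hab : a + p ≤ b ∨ b + p ≤ a) (hq : q < 2 * p)
    (hq' : q' < 2 * p) (h : halvesPosition p a b q = halvesPosition p a b q') : q = q' := by
  have := halvesPosition_spec p a b q
  have := halvesPosition_spec p a b q'
  omega

/-- `halvesPosition` composed with `zigzagIndex` takes values in two blocks of length `p`. -/
theorem halvesPosition_zigzagIndex_mem {p d : ℕ} (a b : ℕ) (hd : d < 2 * p) :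
    (2 * d ≤ p ∨ 3 * p < 2 * d) ∧ a ≤ halvesPosition p a b (zigzagIndex p d) ∧
        halvesPosition p a b (zigzagIndex p d) < a + p ∨
      (p < 2 * d ∧ 2 * d ≤ 3 * p) ∧ b ≤ halvesPosition p a b (zigzagIndex p d) ∧
        halvesPosition p a b (zigzagIndex p d) < b + p := by
  have := halvesPosition_spec p a b (zigzagIndex p d)
  have := zigzagIndex_lt hd
  have := zigzagIndex_lt_iff hd
  omega

/-- The position of the `j`-th vertex of kind `x` in the `r`-th planar layer. The line is cut into
six blocks of length `p`, and the vertices `r` and `r + p` of the three kinds are the first vertices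
of the blocks; each of them is joined to all vertices of the two preceding blocks, cyclically. -/
def layerPosition (p r : ℕ) (x : Fin 3) (j : ℕ) : ℕ :=
  match x with
  | 0 => halvesPosition p 0 (3 * p) (zigzagIndex p (modSub (2 * p) j r))
  | 1 => halvesPosition p (2 * p) (5 * p) (zigzagIndex p (modSub (2 * p) r j))
  | 2 => halvesPosition p (4 * p) p (zigzagIndex p (modSub (2 * p) j r))

/-- Edges drawn above the line in a layer. -/
def upperPage (p a b : ℕ) : Prop :=
  b = a + 1 ∨ b = 2 * p ∨ 2 * p ≤ a ∧ b = 4 * p ∨ a = 0 ∧ 4 * p ≤ b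

/-- Edges drawn below the line in a layer. -/
def lowerPage (p a b : ℕ) : Prop :=
  b = p ∨ a = p ∧ 5 * p ≤ b ∨ p ≤ a ∧ b = 3 * p ∨ 3 * p ≤ a ∧ b = 5 * p

theorem isNoncrossing_upperPage (p : ℕ) : IsNoncrossing (upperPage p) := by
  unfold upperPage
  intro a b c d
  omega

theorem isNoncrossing_lowerPage (p : ℕ) : IsNoncrossing (lowerPage p) := by
  unfold lowerPage
  intro a b c d
  omega

/-- The position of the `j`-th vertex of kind `x` in the last layer. -/
def lastPosition (p : ℕ) (x : Fin 3) (j : ℕ) : ℕ :=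
  match x with
  | 0 => if j < p then 6 * j + 1 else 6 * (j - p) + 2
  | 1 => if j < p then 6 * j + 5 else 6 * (j - p) + 6
  | 2 => if modSub (2 * p) j (p / 2) < p then 6 * modSub (2 * p) j (p / 2) + 3
      else 6 * (modSub (2 * p) j (p / 2) - p) + 4

/-- Edges drawn below the line in the last layer. -/
def lastLowerPage (a b : ℕ) : Prop := b = a + 1 ∨ a % 6 = 1 ∧ b = a + 3

theorem isNoncrossing_lastLowerPage : IsNoncrossing lastLowerPage := by
  unfold lastLowerPage
  intro a b c d
  omega

theorem isNoncrossing_eq_zero : IsNoncrossing fun a _ ↦ a = 0 := by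
  intro a b c d
  omega

theorem zero_position_mem {p r j : ℕ} (hr : r < p) (hj : j < 2 * p) :
    let d := modSub (2 * p) j r
    (2 * d ≤ p ∨ 3 * p < 2 * d) ∧ layerPosition p r 0 j < p ∨
      (p < 2 * d ∧ 2 * d ≤ 3 * p) ∧ 3 * p ≤ layerPosition p r 0 j ∧
        layerPosition p r 0 j < 4 * p := by
  have := halvesPosition_zigzagIndex_mem 0 (3 * p)
    (modSub_lt hj (by omega : r ≤ 2 * p))
  simp only [layerPosition]
  omega

theorem one_position_mem {p r j : ℕ} (hr : r < p) (hj : j < 2 * p) :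
    let d := modSub (2 * p) r j
    (2 * d ≤ p ∨ 3 * p < 2 * d) ∧ 2 * p ≤ layerPosition p r 1 j ∧
        layerPosition p r 1 j < 3 * p ∨
      (p < 2 * d ∧ 2 * d ≤ 3 * p) ∧ 5 * p ≤ layerPosition p r 1 j ∧
        layerPosition p r 1 j < 6 * p := by
  have := halvesPosition_zigzagIndex_mem (2 * p) (5 * p)
    (modSub_lt (by omega : r < 2 * p) hj.le)
  simp only [layerPosition]
  omega

theorem two_position_mem {p r j : ℕ} (hr : r < p) (hj : j < 2 * p) :
    let d := modSub (2 * p) j r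
    (2 * d ≤ p ∨ 3 * p < 2 * d) ∧ 4 * p ≤ layerPosition p r 2 j ∧
        layerPosition p r 2 j < 5 * p ∨
      (p < 2 * d ∧ 2 * d ≤ 3 * p) ∧ p ≤ layerPosition p r 2 j ∧
        layerPosition p r 2 j < 2 * p := by
  have := halvesPosition_zigzagIndex_mem (4 * p) p
    (modSub_lt hj (by omega : r ≤ 2 * p))
  simp only [layerPosition]
  omega

theorem layerPosition_lt {p r j : ℕ} (hr : r < p) (hj : j < 2 * p) (x : Fin 3) :
    layerPosition p r x j < 6 * p := by
  have h₀ := zero_position_mem hr hj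
  have h₁ := one_position_mem hr hj
  have h₂ := two_position_mem hr hj
  match x with
  | 0 => omega
  | 1 => omega
  | 2 => omega

theorem layerPosition_injective {p r : ℕ} (hr : r < p) {x y : Fin 3} {j k : ℕ} (hj : j < 2 * p)
    (hk : k < 2 * p) (h : layerPosition p r x j = layerPosition p r y k) : x = y ∧ j = k := by
  have h₀ := zero_position_mem hr hj
  have h₁ := one_position_mem hr hj
  have h₂ := two_position_mem hr hj
  have h₀' := zero_position_mem hr hk
  have h₁' := one_position_mem hr hk
  have h₂' := two_position_mem hr hk
  have hr' : r < 2 * p := by omega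
  obtain rfl : x = y := by
    match x, y with
    | 0, 0 | 1, 1 | 2, 2 => rfl
    | 0, 1 | 0, 2 | 1, 0 | 1, 2 | 2, 0 | 2, 1 => omega
  refine ⟨rfl, ?_⟩
  match x with
  | 0 =>
    have hj' := modSub_lt hj hr'.le
    have hk' := modSub_lt hk hr'.le
    exact modSub_left_injective hj hk hr'.le (zigzagIndex_injective hj' hk'
      (halvesPosition_injective (by omega) (zigzagIndex_lt hj') (zigzagIndex_lt hk') h))
  | 1 =>
    have hj' := modSub_lt hr' hj.le
    have hk' := modSub_lt hr' hk.le
    exact modSub_right_injective hj hk (zigzagIndex_injective hj' hk'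
      (halvesPosition_injective (by omega) (zigzagIndex_lt hj') (zigzagIndex_lt hk') h))
  | 2 =>
    have hj' := modSub_lt hj hr'.le
    have hk' := modSub_lt hk hr'.le
    exact modSub_left_injective hj hk hr'.le (zigzagIndex_injective hj' hk'
      (halvesPosition_injective (by omega) (zigzagIndex_lt hj') (zigzagIndex_lt hk') h))

theorem lastPosition_pos (p : ℕ) (x : Fin 3) (j : ℕ) : 0 < lastPosition p x j := by
  fin_cases x <;> simp only [lastPosition] <;> split_ifs <;> omega

theorem lastPosition_spec (p : ℕ) (x : Fin 3) (j : ℕ) :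
    let j' := if x = 2 then modSub (2 * p) j (p / 2) else j
    let c := if x = 0 then 1 else if x = 1 then 5 else 3
    j' < p ∧ lastPosition p x j = 6 * j' + c ∨
      p ≤ j' ∧ lastPosition p x j = 6 * (j' - p) + c + 1 := by
  match x with
  | 0 | 1 | 2 =>
    simp only [lastPosition, reduceIte, Fin.reduceEq]
    split_ifs <;> omega

theorem lastPosition_injective {p : ℕ} {x y : Fin 3} {j k : ℕ} (hj : j < 2 * p)
    (hk : k < 2 * p) (h : lastPosition p x j = lastPosition p y k) : x = y ∧ j = k := by
  have h₁ := lastPosition_spec p x j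
  have h₂ := lastPosition_spec p y k
  have h₃ := modSub_spec (a := j) (by omega : p / 2 ≤ 2 * p)
  have h₄ := modSub_spec (a := k) (by omega : p / 2 ≤ 2 * p)
  match x, y with
  | 0, 0 | 1, 1 | 2, 2 =>
    simp only [reduceIte, Fin.reduceEq] at h₁ h₂
    exact ⟨rfl, by omega⟩
  | 0, 1 | 0, 2 | 1, 0 | 1, 2 | 2, 0 | 2, 1 =>
    simp only [reduceIte, Fin.reduceEq] at h₁ h₂
    omega

/-- The planar layer, as a graph on positions. -/
def layerGraph (p : ℕ) : SimpleGraph ℕ :=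
  ofPositions id fun a b ↦ upperPage p a b ∨ lowerPage p a b

/-- The last planar layer, as a graph on positions. -/
def lastGraph : SimpleGraph ℕ := ofPositions id fun a b ↦ a = 0 ∨ lastLowerPage a b

theorem layerGraph_adj {p a b : ℕ} : (layerGraph p).Adj a b ↔
    a < b ∧ (upperPage p a b ∨ lowerPage p a b) ∨ b < a ∧ (upperPage p b a ∨ lowerPage p b a) :=
  Iff.rfl

theorem lastGraph_adj {a b : ℕ} : lastGraph.Adj a b ↔
    a < b ∧ (a = 0 ∨ lastLowerPage a b) ∨ b < a ∧ (b = 0 ∨ lastLowerPage b a) :=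
  Iff.rfl

theorem layerGraph_adj_special {p a : ℕ} (hp : 0 < p) :
    (4 * p ≤ a → (layerGraph p).Adj a 0) ∧
    (a < p ∨ 5 * p ≤ a → (layerGraph p).Adj a p) ∧
    (a < 2 * p → (layerGraph p).Adj a (2 * p)) ∧
    (p ≤ a ∧ a < 3 * p → (layerGraph p).Adj a (3 * p)) ∧
    (2 * p ≤ a ∧ a < 4 * p → (layerGraph p).Adj a (4 * p)) ∧
    (3 * p ≤ a ∧ a < 5 * p → (layerGraph p).Adj a (5 * p)) := by
  refine ⟨?_, ?_, ?_, ?_, ?_, ?_⟩ <;> intro h <;> rw [layerGraph_adj] <;>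
    unfold upperPage lowerPage <;> omega

theorem layerGraph_adj_succ {p a b : ℕ} (h : a + 1 = b ∨ b + 1 = a) : (layerGraph p).Adj a b := by
  rw [layerGraph_adj]
  unfold upperPage
  omega

theorem layerPosition_special {p r : ℕ} (hr : r < p) :
    layerPosition p r 0 r = 0 ∧ layerPosition p r 0 (r + p) = 3 * p ∧
    layerPosition p r 1 r = 2 * p ∧ layerPosition p r 1 (r + p) = 5 * p ∧
    layerPosition p r 2 r = 4 * p ∧ layerPosition p r 2 (r + p) = p := by
  have h₀ : modSub (2 * p) r r = 0 := by simp [modSub]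
  have h₁ : modSub (2 * p) (r + p) r = p := by simp [modSub]
  have h₂ : modSub (2 * p) r (r + p) = p := by
    have := modSub_spec (a := r) (by omega : r + p ≤ 2 * p)
    omega
  have h₃ : zigzagIndex p 0 = 0 := by simp [zigzagIndex]
  have h₄ : zigzagIndex p p = 2 * p - 1 := by
    have := zigzagIndex_spec p p
    omega
  have h₅ : ∀ a b, halvesPosition p a b 0 = a := fun a b ↦ by
    have := halvesPosition_spec p a b 0
    omega
  have h₆ : ∀ a b, halvesPosition p a b (2 * p - 1) = b := fun a b ↦ by
    have := halvesPosition_spec p a b (2 * p - 1)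
    omega
  simp only [layerPosition, h₀, h₁, h₂, h₃, h₄, h₅, h₆, and_self]

theorem exists_eq_or_eq_add {p k : ℕ} (hk : k < 2 * p) : ∃ r < p, k = r ∨ k = r + p := by
  by_cases h : k < p
  · exact ⟨k, h, .inl rfl⟩
  · exact ⟨k - p, by omega, by omega⟩

theorem exists_layerGraph_adj_zero_one {p j k : ℕ} (hj : j < 2 * p) (hk : k < 2 * p) :
    ∃ r < p, (layerGraph p).Adj (layerPosition p r 0 j) (layerPosition p r 1 k) := by
  have he := modSub_spec (a := j) hk.le
  by_cases hN : 2 * modSub (2 * p) j k ≤ p ∨ 3 * p < 2 * modSub (2 * p) j k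
  · obtain ⟨r, hr, hkr⟩ := exists_eq_or_eq_add hk
    refine ⟨r, hr, ?_⟩
    have h₁ := zero_position_mem hr hj
    have h₂ := modSub_spec (a := j) (by omega : r ≤ 2 * p)
    obtain ⟨-, -, s₁, s₂, -, -⟩ := layerPosition_special hr
    obtain ⟨-, -, f₁, -, -, f₂⟩ := layerGraph_adj_special (a := layerPosition p r 0 j)
      (by omega : 0 < p)
    rcases hkr with rfl | rfl
    · rw [s₁]; exact f₁ (by omega)
    · rw [s₂]; exact f₂ (by omega)
  · obtain ⟨r, hr, hjr⟩ := exists_eq_or_eq_add hj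
    refine ⟨r, hr, ?_⟩
    have h₁ := one_position_mem hr hk
    have h₂ := modSub_spec (a := r) hk.le
    obtain ⟨s₁, s₂, -, -, -, -⟩ := layerPosition_special hr
    obtain ⟨f₁, -, -, f₂, -, -⟩ := layerGraph_adj_special (a := layerPosition p r 1 k)
      (by omega : 0 < p)
    rcases hjr with rfl | rfl
    · rw [s₁]; exact (f₁ (by omega)).symm
    · rw [s₂]; exact (f₂ (by omega)).symm

theorem exists_layerGraph_adj_one_two {p j k : ℕ} (hj : j < 2 * p) (hk : k < 2 * p) :
    ∃ r < p, (layerGraph p).Adj (layerPosition p r 1 j) (layerPosition p r 2 k) := by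
  have he := modSub_spec (a := k) hj.le
  by_cases hN : 2 * modSub (2 * p) k j ≤ p ∨ 3 * p < 2 * modSub (2 * p) k j
  · obtain ⟨r, hr, hkr⟩ := exists_eq_or_eq_add hk
    refine ⟨r, hr, ?_⟩
    have h₁ := one_position_mem hr hj
    have h₂ := modSub_spec (a := r) hj.le
    obtain ⟨-, -, -, -, s₁, s₂⟩ := layerPosition_special hr
    obtain ⟨-, f₂, -, -, f₁, -⟩ := layerGraph_adj_special (a := layerPosition p r 1 j)
      (by omega : 0 < p)
    rcases hkr with rfl | rfl
    · rw [s₁]; exact f₁ (by omega)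
    · rw [s₂]; exact f₂ (by omega)
  · obtain ⟨r, hr, hjr⟩ := exists_eq_or_eq_add hj
    refine ⟨r, hr, ?_⟩
    have h₁ := two_position_mem hr hk
    have h₂ := modSub_spec (a := k) (by omega : r ≤ 2 * p)
    obtain ⟨-, -, s₁, s₂, -, -⟩ := layerPosition_special hr
    obtain ⟨-, -, f₁, -, -, f₂⟩ := layerGraph_adj_special (a := layerPosition p r 2 k)
      (by omega : 0 < p)
    rcases hjr with rfl | rfl
    · rw [s₁]; exact (f₁ (by omega)).symm
    · rw [s₂]; exact (f₂ (by omega)).symm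

theorem exists_layerGraph_adj_two_zero {p j k : ℕ} (hj : j < 2 * p) (hk : k < 2 * p)
    (h : 2 * modSub (2 * p) j k ≠ 3 * p) :
    ∃ r < p, (layerGraph p).Adj (layerPosition p r 2 j) (layerPosition p r 0 k) := by
  have he := modSub_spec (a := j) hk.le
  by_cases hN : 2 * modSub (2 * p) j k ≤ p ∨ 3 * p < 2 * modSub (2 * p) j k
  · obtain ⟨r, hr, hkr⟩ := exists_eq_or_eq_add hk
    refine ⟨r, hr, ?_⟩
    have h₁ := two_position_mem hr hj
    have h₂ := modSub_spec (a := j) (by omega : r ≤ 2 * p)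
    obtain ⟨s₁, s₂, -, -, -, -⟩ := layerPosition_special hr
    obtain ⟨f₁, -, -, f₂, -, -⟩ := layerGraph_adj_special (a := layerPosition p r 2 j)
      (by omega : 0 < p)
    rcases hkr with rfl | rfl
    · rw [s₁]; exact f₁ (by omega)
    · rw [s₂]; exact f₂ (by omega)
  · obtain ⟨r, hr, hjr⟩ := exists_eq_or_eq_add hj
    refine ⟨r, hr, ?_⟩
    have h₁ := zero_position_mem hr hk
    have h₂ := modSub_spec (a := k) (by omega : r ≤ 2 * p)
    obtain ⟨-, -, -, -, s₁, s₂⟩ := layerPosition_special hr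
    obtain ⟨-, f₂, -, -, f₁, -⟩ := layerGraph_adj_special (a := layerPosition p r 0 k)
      (by omega : 0 < p)
    rcases hjr with rfl | rfl
    · rw [s₁]; exact (f₁ (by omega)).symm
    · rw [s₂]; exact (f₂ (by omega)).symm

theorem lastGraph_adj_two_zero {p j k : ℕ} (hj : j < 2 * p) (hk : k < 2 * p)
    (h : 2 * modSub (2 * p) j k = 3 * p) :
    lastGraph.Adj (lastPosition p 2 j) (lastPosition p 0 k) := by
  have h₁ := lastPosition_spec p 2 j
  have h₂ := lastPosition_spec p 0 k
  have h₃ := modSub_spec (a := j) (by omega : p / 2 ≤ 2 * p)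
  have h₄ := modSub_spec (a := j) hk.le
  simp only [reduceIte, Fin.reduceEq] at h₁ h₂
  rw [lastGraph_adj]
  unfold lastLowerPage
  omega

theorem lastGraph_adj_antipodal {p j : ℕ} (hj : j < p) (x : Fin 3) :
    lastGraph.Adj (lastPosition p x j) (lastPosition p x (j + p)) := by
  have h₁ := lastPosition_spec p x j
  have h₂ := lastPosition_spec p x (j + p)
  have h₃ := modSub_spec (a := j) (by omega : p / 2 ≤ 2 * p)
  have h₄ := modSub_spec (a := j + p) (by omega : p / 2 ≤ 2 * p)
  rw [lastGraph_adj]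
  unfold lastLowerPage
  match x with
  | 0 | 1 | 2 =>
    simp only [reduceIte, Fin.reduceEq] at h₁ h₂
    omega

theorem layerGraph_adj_halvesPosition {p d e : ℕ} (a b : ℕ) (hd : d < 2 * p) (he : e < 2 * p)
    (hne : d ≠ e) (hde : d + e = 1 ∨ d + e = 2 * p ∨ d + e = 2 * p + 1)
    (hp : d ≠ e + p ∧ e ≠ d + p) :
    (layerGraph p).Adj (halvesPosition p a b (zigzagIndex p d))
      (halvesPosition p a b (zigzagIndex p e)) := by
  have h₁ := zigzagIndex_spec p d
  have h₂ := zigzagIndex_spec p e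
  have h₃ : zigzagIndex p d + 1 = zigzagIndex p e ∨ zigzagIndex p e + 1 = zigzagIndex p d := by
    omega
  have h₄ := halvesPosition_spec p a b (zigzagIndex p d)
  have h₅ := halvesPosition_spec p a b (zigzagIndex p e)
  have h₆ := zigzagIndex_lt hd
  have h₇ := zigzagIndex_lt he
  exact layerGraph_adj_succ (by omega)

theorem exists_layerGraph_adj_self {p j k : ℕ} (hjk : j < k) (hk : k < 2 * p)
    (hp : k ≠ j + p) (x : Fin 3) :
    ∃ r < p, (layerGraph p).Adj (layerPosition p r x j) (layerPosition p r x k) := by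
  obtain ⟨r, hr, hrs⟩ : ∃ r < p,
      (if x = 1 then j + k = 2 * r ∨ j + k + 1 = 2 * r ∨ j + k = 2 * r + 2 * p ∨
          j + k + 1 = 2 * r + 2 * p ∨ j + k + 1 = 2 * r + 4 * p
        else j + k = 2 * r ∨ j + k = 2 * r + 1 ∨ j + k = 2 * r + 2 * p ∨
          j + k = 2 * r + 2 * p + 1) := by
    split_ifs
    · by_cases h₁ : (j + k + 1) / 2 < p
      · exact ⟨(j + k + 1) / 2, h₁, by omega⟩
      by_cases h₂ : (j + k + 1) / 2 < 2 * p
      · exact ⟨(j + k + 1) / 2 - p, by omega, by omega⟩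
      · exact ⟨0, by omega, by omega⟩
    · by_cases h₁ : (j + k) / 2 < p
      · exact ⟨(j + k) / 2, h₁, by omega⟩
      · exact ⟨(j + k) / 2 - p, by omega, by omega⟩
  refine ⟨r, hr, ?_⟩
  have hr' : r < 2 * p := by omega
  have hj' : j < 2 * p := by omega
  match x with
  | 0 | 2 =>
    have h₁ := modSub_spec (a := j) hr'.le
    have h₂ := modSub_spec (a := k) hr'.le
    simp only [reduceIte, Fin.reduceEq] at hrs
    exact layerGraph_adj_halvesPosition _ _ (modSub_lt hj' hr'.le) (modSub_lt hk hr'.le)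
      (by omega) (by omega) (by omega)
  | 1 =>
    have h₁ := modSub_spec (a := r) hj'.le
    have h₂ := modSub_spec (a := r) hk.le
    simp only [reduceIte] at hrs
    exact layerGraph_adj_halvesPosition _ _ (modSub_lt hr' hj'.le) (modSub_lt hr' hk.le)
      (by omega) (by omega) (by omega)

/-- The position of a vertex in a planar layer; the extra vertex `none` comes last. -/
def layerVertexPosition (p r : ℕ) : Option (Fin 3 × Fin (2 * p)) → ℕ
  | none => 6 * p
  | some (x, j) => layerPosition p r x j

/-- The position of a vertex in the last planar layer; the extra vertex `none` comes first. -/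
def lastVertexPosition (p : ℕ) : Option (Fin 3 × Fin (2 * p)) → ℕ
  | none => 0
  | some (x, j) => lastPosition p x j

theorem layerVertexPosition_injective {p r : ℕ} (hr : r < p) :
    Function.Injective (layerVertexPosition p r) := by
  rintro (_ | ⟨x, j⟩) (_ | ⟨y, k⟩) h
  · rfl
  · exact absurd h (layerPosition_lt hr k.2 y).ne'
  · exact absurd h (layerPosition_lt hr j.2 x).ne
  · obtain ⟨rfl, hjk⟩ := layerPosition_injective hr j.2 k.2 h
    rw [Fin.ext hjk]

theorem lastVertexPosition_injective (p : ℕ) : Function.Injective (lastVertexPosition p) := by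
  rintro (_ | ⟨x, j⟩) (_ | ⟨y, k⟩) h
  · rfl
  · exact absurd h (lastPosition_pos p y k).ne
  · exact absurd h (lastPosition_pos p x j).ne'
  · obtain ⟨rfl, hjk⟩ := lastPosition_injective j.2 k.2 h
    rw [Fin.ext hjk]

theorem isPlanar_comap_layerGraph {V : Type*} (p : ℕ) {pos : V → ℕ}
    (hpos : Function.Injective pos) : ((layerGraph p).comap pos).IsPlanar :=
  isPlanar_ofPositions hpos (isNoncrossing_upperPage p) (isNoncrossing_lowerPage p)

theorem isPlanar_comap_lastGraph {V : Type*} {pos : V → ℕ} (hpos : Function.Injective pos) :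
    (lastGraph.comap pos).IsPlanar :=
  isPlanar_ofPositions hpos isNoncrossing_eq_zero isNoncrossing_lastLowerPage

theorem lastGraph_adj_zero {a : ℕ} (ha : 0 < a) : lastGraph.Adj 0 a :=
  .inl ⟨ha, .inl rfl⟩

/-- The layers cover all edges of the complete graph. -/
theorem adj_last_or_exists_adj_layer {p : ℕ} {u v : Option (Fin 3 × Fin (2 * p))} (huv : u ≠ v) :
    (lastGraph.comap (lastVertexPosition p)).Adj u v ∨
      ∃ r < p, ((layerGraph p).comap (layerVertexPosition p r)).Adj u v := by
  have self : ∀ {x : Fin 3} {j k : Fin (2 * p)}, j < k →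
      (lastGraph.comap (lastVertexPosition p)).Adj (some (x, j)) (some (x, k)) ∨
      ∃ r < p, ((layerGraph p).comap (layerVertexPosition p r)).Adj
        (some (x, j)) (some (x, k)) := by
    intro x j k hjk
    by_cases hp : (k : ℕ) = j + p
    · have := lastGraph_adj_antipodal (p := p) (by omega : (j : ℕ) < p) x
      rw [← hp] at this
      exact .inl this
    · exact .inr (exists_layerGraph_adj_self hjk k.2 hp x)
  have next : ∀ (x : Fin 3) (j k : Fin (2 * p)),
      (lastGraph.comap (lastVertexPosition p)).Adj (some (x, j)) (some (x + 1, k)) ∨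
      ∃ r < p, ((layerGraph p).comap (layerVertexPosition p r)).Adj
        (some (x, j)) (some (x + 1, k)) := by
    intro x j k
    match x with
    | 0 => exact .inr (exists_layerGraph_adj_zero_one j.2 k.2)
    | 1 => exact .inr (exists_layerGraph_adj_one_two j.2 k.2)
    | 2 =>
      by_cases h : 2 * modSub (2 * p) j k = 3 * p
      · exact .inl (lastGraph_adj_two_zero j.2 k.2 h)
      · exact .inr (exists_layerGraph_adj_two_zero j.2 k.2 h)
  have symm : ∀ {u v}, ((lastGraph.comap (lastVertexPosition p)).Adj v u ∨
      ∃ r < p, ((layerGraph p).comap (layerVertexPosition p r)).Adj v u) →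
      (lastGraph.comap (lastVertexPosition p)).Adj u v ∨
      ∃ r < p, ((layerGraph p).comap (layerVertexPosition p r)).Adj u v :=
    fun h ↦ h.imp .symm fun ⟨r, hr, h⟩ ↦ ⟨r, hr, h.symm⟩
  rcases u with _ | ⟨x, j⟩ <;> rcases v with _ | ⟨y, k⟩
  · exact absurd rfl huv
  · exact .inl (lastGraph_adj_zero (lastPosition_pos p y k))
  · exact .inl (lastGraph_adj_zero (lastPosition_pos p x j)).symm
  · obtain rfl | rfl | rfl : x = y ∨ y = x + 1 ∨ x = y + 1 := by
      clear huv; revert x y; decide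
    · rcases lt_trichotomy j k with h | rfl | h
      · exact self h
      · exact absurd rfl huv
      · exact symm (self h)
    · exact next x j k
    · exact symm (next y k j)

theorem exists_isPlanar_iSup_eq_top (p : ℕ) :
    ∃ f : Fin (p + 1) → SimpleGraph (Fin (6 * p + 1)), (∀ i, (f i).IsPlanar) ∧ ⨆ i, f i = ⊤ := by
  let e : Fin (6 * p + 1) ≃ Option (Fin 3 × Fin (2 * p)) :=
    Fintype.equivOfCardEq (by simp; ring)
  refine ⟨Fin.lastCases (lastGraph.comap (lastVertexPosition p ∘ e))
    fun r ↦ (layerGraph p).comap (layerVertexPosition p r ∘ e), fun i ↦ ?_, ?_⟩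
  · cases i using Fin.lastCases with
    | last =>
      simpa using isPlanar_comap_lastGraph ((lastVertexPosition_injective p).comp e.injective)
    | cast r =>
      simpa using
        isPlanar_comap_layerGraph p ((layerVertexPosition_injective r.2).comp e.injective)
  · ext u v
    simp only [iSup_adj, top_adj]
    refine ⟨fun ⟨_, h⟩ ↦ h.ne, fun huv ↦ ?_⟩
    rcases adj_last_or_exists_adj_layer (e.injective.ne huv) with h | ⟨r, hr, h⟩
    · exact ⟨Fin.last p, by simpa using h⟩
    · exact ⟨Fin.castSucc ⟨r, hr⟩, by rw [Fin.lastCases_castSucc]; exact h⟩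

/-- For every `t ≥ 1`, the thickness of `K_{6t+1}` equals `t + 1`. -/
theorem thickness_completeGraph_six_mul_add_one (t : ℕ) (ht : 1 ≤ t) :
    (⊤ : SimpleGraph (Fin (6 * t + 1))).thickness = t + 1 := by
  have hmem := exists_isPlanar_iSup_eq_top t
  refine le_antisymm (Nat.sInf_le hmem) (le_csInf ⟨t + 1, hmem⟩ ?_)
  rintro k ⟨f, hf, hsup⟩
  by_contra! hk
  have h := card_edgeFinset_le_of_iSup_eq hf hsup
  have hchoose : (6 * t + 1).choose 2 = 3 * t * (6 * t + 1) := by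
    rw [Nat.choose_two_right, Nat.add_sub_cancel]
    exact Nat.div_eq_of_eq_mul_left two_pos (by ring)
  rw [card_edgeFinset_top_eq_card_choose_two, Fintype.card_fin, hchoose,
    show 3 * (6 * t + 1) - 3 = 18 * t by omega] at h
  nlinarith [Nat.mul_le_mul_right (18 * t) (Nat.lt_succ_iff.1 hk)]
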